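/- A finite subgroup of PGL₂(k̄), where k̄ is an algebraically closed field of characteristic ℓ > 5, whose order is prime to ℓ is cyclic, dihedral, or isomorphic to A₄, S₄, or A₅. -/

import Mathlib

theorem alt_of_embed {G : Type*} [Group G] [Finite G] (n : ℕ) [Nontrivial (Fin n)] (f : G →* Equiv.Perm (Fin n))
    (hf : Function.Injective f) (hc : 2 * Nat.card G = n.factorial) :
    Nonempty (G ≃* alternatingGroup (Fin n)) := by
  have h1 : Nat.card f.range = Nat.card G :=
    (Nat.card_congr (MonoidHom.ofInjective hf).toEquiv).symm
  have h2 : f.range.index = 2 := by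
    have := f.range.card_mul_index
    rw [h1, Nat.card_perm, Nat.card_fin, ← hc] at this
    have hp : 0 < Nat.card G := Nat.card_pos
    nlinarith
  have h3 := Equiv.Perm.eq_alternatingGroup_of_index_eq_two h2
  exact ⟨(MonoidHom.ofInjective hf).trans (MulEquiv.subgroupCongr h3)⟩

theorem sym_of_embed {G : Type*} [Group G] [Finite G] (n : ℕ) (f : G →* Equiv.Perm (Fin n))
    (hf : Function.Injective f) (hc : Nat.card G = n.factorial) :
    Nonempty (G ≃* Equiv.Perm (Fin n)) := by
  refine ⟨MulEquiv.ofBijective f ((Nat.bijective_iff_injective_and_card f).2 ⟨hf, ?_⟩)⟩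
  rw [hc, Nat.card_perm, Nat.card_fin]

theorem dihedral_of {G : Type*} [Group G] [Finite G] (C : Subgroup G) [IsCyclic C]
    (hi : Nat.card G = 2 * Nat.card C) (h : ∀ g ∉ C, g * g = 1) :
    Nonempty (G ≃* DihedralGroup (Nat.card C)) := by
  obtain ⟨⟨c, hcC⟩, hc⟩ := IsCyclic.exists_generator (α := C)
  have hgen : ∀ x ∈ C, ∃ k : ℤ, c ^ k = x := by
    intro x hx
    obtain ⟨k, hk⟩ := hc ⟨x, hx⟩
    exact ⟨k, by simpa using congrArg Subtype.val hk⟩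
  have hpos : 0 < Nat.card C := Nat.card_pos
  have hne : ∃ t, t ∉ C := by
    by_contra hcon
    push Not at hcon
    have : C = ⊤ := by ext; simp [hcon]
    rw [this, Subgroup.card_top] at hi
    have : 0 < Nat.card G := Nat.card_pos
    omega
  obtain ⟨t, ht⟩ := hne
  have htt := h t ht
  have hinv : t⁻¹ = t := inv_eq_of_mul_eq_one_left htt
  have htc : ∀ k : ℤ, c ^ k * t = t * c ^ (-k) := by
    intro k
    have h1 : t * c ^ k ∉ C := fun hh => ht ((C.mul_mem_cancel_right (C.zpow_mem hcC k)).1 hh)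
    have h2 := h _ h1
    have : c ^ k * t = t⁻¹ * (t * c ^ k * (t * c ^ k)) * (c ^ k)⁻¹ := by group
    rw [this, h2, hinv]; simp
  have hord : orderOf c = Nat.card C := by
    have := orderOf_eq_card_of_forall_mem_zpowers hc
    rw [← this]; simp
  have hz : ∀ a b : ℤ, ((a : ZMod (Nat.card C)) = b) ↔ c ^ a = c ^ b := by
    intro a b
    rw [ZMod.intCast_eq_intCast_iff, zpow_eq_zpow_iff_modEq, hord]
  have : NeZero (Nat.card C) := ⟨hpos.ne'⟩
  let n := Nat.card C
  let e : ZMod n → ℤ := fun i => (i.val : ℤ)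
  have he : ∀ i : ZMod n, ((e i : ℤ) : ZMod n) = i := by intro i; simp [e]
  let φ : DihedralGroup n → G := fun x => match x with
    | .r i => c ^ e i
    | .sr i => t * c ^ e i
  have hφ : ∀ x y, φ (x * y) = φ x * φ y := by
    rintro (i | i) (j | j)
    · show c ^ e (i + j) = c ^ e i * c ^ e j
      rw [← _root_.zpow_add, ← hz]; push_cast [he]; rfl
    · show t * c ^ e (j - i) = c ^ e i * (t * c ^ e j)
      rw [← mul_assoc, htc, mul_assoc, ← _root_.zpow_add]; congr 1; rw [← hz]; push_cast [he]; ring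
    · show t * c ^ e (i + j) = t * c ^ e i * c ^ e j
      rw [mul_assoc, ← _root_.zpow_add]; congr 1; rw [← hz]; push_cast [he]; rfl
    · show c ^ e (j - i) = t * c ^ e i * (t * c ^ e j)
      rw [mul_assoc, ← mul_assoc (c ^ e i), htc, mul_assoc, ← mul_assoc t, htt, one_mul, ← _root_.zpow_add,
        ← hz]; push_cast [he]; ring
  let Φ : DihedralGroup n →* G := MonoidHom.mk' φ hφ
  have hinj : Function.Injective Φ := by
    rw [injective_iff_map_eq_one]
    rintro (i | i) hx
    · have hx : c ^ e i = 1 := hx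
      rw [← zpow_zero c, ← hz, he] at hx
      rw [hx]; simp
    · have hx : t * c ^ e i = 1 := hx
      exact absurd (by rw [eq_inv_of_mul_eq_one_left hx]; exact C.inv_mem (C.zpow_mem hcC _)) ht
  refine ⟨(MulEquiv.ofBijective Φ ((Nat.bijective_iff_injective_and_card Φ).2 ⟨hinj, ?_⟩)).symm⟩
  rw [DihedralGroup.nat_card, hi]

/-- The number-theoretic core. -/
theorem numbers (N m1 m2 m3 n1 n2 n3 : ℕ) (h1 : m1 * n1 = N) (h2 : m2 * n2 = N) (h3 : m3 * n3 = N)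
    (k1 : 2 ≤ n1) (k2 : 2 ≤ n2) (k3 : 2 ≤ n3) (l12 : n1 ≤ n2) (l23 : n2 ≤ n3)
    (hs : m1 + m2 + m3 = N + 2) :
    (n1 = 2 ∧ n2 = 2 ∧ N = 2 * n3) ∨ (n1 = 2 ∧ n2 = 3 ∧ n3 = 3 ∧ N = 12) ∨
    (n1 = 2 ∧ n2 = 3 ∧ n3 = 4 ∧ N = 24) ∨ (n1 = 2 ∧ n2 = 3 ∧ n3 = 5 ∧ N = 60) := by
  have m32 : m3 ≤ m2 := by by_contra h; push Not at h; nlinarith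
  have m21 : m2 ≤ m1 := by by_contra h; push Not at h; nlinarith
  have e1 : n1 = 2 := by
    by_contra h
    have : 3 ≤ n1 := by omega
    have : 3 * m1 ≤ N := by nlinarith
    omega
  subst e1
  have e2 : n2 ≤ 3 := by
    by_contra h
    have : 4 ≤ n2 := by omega
    have : 4 * m2 ≤ N := by nlinarith
    omega
  interval_cases n2
  · left
    refine ⟨rfl, rfl, ?_⟩
    have : m3 = 2 := by omega
    subst this; omega
  · right
    have e3 : n3 ≤ 5 := by
      by_contra h
      have : 6 ≤ n3 := by omega
      have : 6 * m3 ≤ N := by nlinarith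
      omega
    interval_cases n3 <;> omega

theorem orb_stab {G X : Type*} [Group G] [MulAction G X] (x : X) :
    Nat.card (MulAction.orbit G x) * Nat.card (MulAction.stabilizer G x) = Nat.card G := by
  rw [← Nat.card_prod]
  exact Nat.card_congr (MulAction.orbitProdStabilizerEquivGroup G x)

theorem mem_all_sylow {G : Type*} [Group G] [Finite G] (p : ℕ) [Fact p.Prime]
    (h : p ∣ Nat.card (MulAction.toPermHom G (Sylow p G)).ker) :
    ∃ g : G, orderOf g = p ∧ ∀ P : Sylow p G, g ∈ P := by
  obtain ⟨⟨g, hg⟩, hgo⟩ := exists_prime_orderOf_dvd_card' p h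
  rw [Subgroup.orderOf_mk] at hgo
  refine ⟨g, hgo, fun P => ?_⟩
  have hp : IsPGroup p (Subgroup.zpowers g) :=
    IsPGroup.of_card (n := 1) (by rw [Nat.card_zpowers, hgo, pow_one])
  have h1 : P ∈ MulAction.fixedPoints (Subgroup.zpowers g) (Sylow p G) := by
    rw [Subgroup.sylow_mem_fixedPoints_iff, Subgroup.zpowers_le, ← Sylow.smul_eq_iff_mem_normalizer]
    rw [MonoidHom.mem_ker] at hg
    exact congrArg (fun e : Equiv.Perm (Sylow p G) => e P) hg
  rw [hp.sylow_mem_fixedPoints_iff, Subgroup.zpowers_le] at h1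
  exact h1

theorem ker_dvd {G : Type*} [Group G] [Finite G] (p : ℕ) [Fact p.Prime] :
    Nat.card (MulAction.toPermHom G (Sylow p G)).ker * Nat.card (Sylow p G) ∣ Nat.card G := by
  obtain ⟨P⟩ : Nonempty (Sylow p G) := inferInstance
  have h1 : (MulAction.toPermHom G (Sylow p G)).ker ≤ Subgroup.normalizer (P : Set G) := by
    intro g hg
    rw [← Sylow.smul_eq_iff_mem_normalizer]
    rw [MonoidHom.mem_ker] at hg
    exact congrArg (fun e : Equiv.Perm (Sylow p G) => e P) hg
  have h2 := Subgroup.card_dvd_of_le h1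
  rw [P.card_eq_index_normalizer, ← (Subgroup.normalizer (P : Set G)).card_mul_index]
  exact Nat.mul_dvd_mul h2 dvd_rfl

theorem embed_of_sylow {G : Type*} [Group G] [Finite G] (p n : ℕ) [Fact p.Prime]
    (hn : Nat.card (Sylow p G) = n)
    (hk : Nat.card (MulAction.toPermHom G (Sylow p G)).ker = 1) :
    ∃ f : G →* Equiv.Perm (Fin n), Function.Injective f := by
  let e : Sylow p G ≃ Fin n := Finite.equivFinOfCardEq hn
  refine ⟨(Equiv.permCongrHom e).toMonoidHom.comp (MulAction.toPermHom G (Sylow p G)), ?_⟩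
  have : Function.Injective (MulAction.toPermHom G (Sylow p G)) := by
    rw [← MonoidHom.ker_eq_bot_iff]
    exact Subgroup.eq_bot_of_card_eq _ hk
  exact (Equiv.permCongrHom e).injective.comp this

theorem octa {G : Type*} [Group G] [Finite G] (hc : Nat.card G = 12 ∨ Nat.card G = 24)
    (hn : ∀ K : Subgroup G, K.Normal → ¬ (Nat.card K).Prime) :
    Nonempty (G ≃* alternatingGroup (Fin 4)) ∨ Nonempty (G ≃* Equiv.Perm (Fin 4)) := by
  have : Fact (Nat.Prime 3) := ⟨Nat.prime_three⟩
  obtain ⟨P⟩ : Nonempty (Sylow 3 G) := inferInstance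
  have f12 : (12 : ℕ).factorization 3 = 1 := by
    rw [show 12 = 3 ^ 1 * 4 by norm_num, Nat.factorization_mul (by norm_num) (by norm_num), Nat.Prime.factorization_pow Nat.prime_three]
    simp [Nat.factorization_eq_zero_of_not_dvd]
  have f24 : (24 : ℕ).factorization 3 = 1 := by
    rw [show 24 = 3 ^ 1 * 8 by norm_num, Nat.factorization_mul (by norm_num) (by norm_num), Nat.Prime.factorization_pow Nat.prime_three]
    simp [Nat.factorization_eq_zero_of_not_dvd]
  have hP : Nat.card P = 3 := by
    rw [P.card_eq_multiplicity]
    rcases hc with hc | hc <;> rw [hc]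
    · rw [f12]; norm_num
    · rw [f24]; norm_num
  have h1 := P.card_dvd_index
  have h2 := (P : Subgroup G).card_mul_index
  rw [show Nat.card (P : Subgroup G) = 3 from hP] at h2
  have h3 := card_sylow_modEq_one 3 G
  have hne1 : Nat.card (Sylow 3 G) ≠ 1 := by
    intro h
    rw [P.card_eq_index_normalizer, Subgroup.index_eq_one] at h
    refine hn P (Subgroup.normalizer_eq_top_iff.1 h) ?_
    rw [show Nat.card (P : Subgroup G) = 3 from hP]; exact Nat.prime_three
  have h8 : Nat.card (Sylow 3 G) ∣ 8 := by
    refine h1.trans ?_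
    rcases hc with hc | hc
    · rw [show (P : Subgroup G).index = 4 by omega]; norm_num
    · rw [show (P : Subgroup G).index = 8 by omega]
  have h4 : Nat.card (Sylow 3 G) = 4 := by
    have hle := Nat.le_of_dvd (by norm_num) h8
    unfold Nat.ModEq at h3
    interval_cases (Nat.card (Sylow 3 G)) <;> omega
  have hk : Nat.card (MulAction.toPermHom G (Sylow 3 G)).ker = 1 := by
    have hd := ker_dvd (G := G) 3
    rw [h4] at hd
    have hd : Nat.card (MulAction.toPermHom G (Sylow 3 G)).ker ∣ 6 := by
      have : Nat.card (MulAction.toPermHom G (Sylow 3 G)).ker * 4 ∣ 6 * 4 := by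
        refine hd.trans ?_
        rcases hc with hc | hc <;> rw [hc]
        norm_num
      exact Nat.dvd_of_mul_dvd_mul_right (by norm_num) this
    have n3 : ¬ 3 ∣ Nat.card (MulAction.toPermHom G (Sylow 3 G)).ker := by
      intro h
      obtain ⟨g, hgo, hg⟩ := mem_all_sylow 3 h
      have : ∀ Q : Sylow 3 G, (Q : Subgroup G) = Subgroup.zpowers g := by
        intro Q
        symm
        apply Subgroup.eq_of_le_of_card_ge
        · rw [Subgroup.zpowers_le]; exact hg Q
        · rw [Nat.card_zpowers, hgo]
          exact ((Nat.card_congr (Sylow.equiv Q P).toEquiv).trans hP).le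
      apply hne1
      rw [Nat.card_eq_one_iff_unique]
      exact ⟨⟨fun A B => Sylow.ext ((this A).trans (this B).symm)⟩, ⟨P⟩⟩
    have n2 : Nat.card (MulAction.toPermHom G (Sylow 3 G)).ker ≠ 2 := by
      intro h
      refine hn (MulAction.toPermHom G (Sylow 3 G)).ker (MonoidHom.normal_ker _) ?_
      rw [h]; exact Nat.prime_two
    generalize Nat.card (MulAction.toPermHom G (Sylow 3 G)).ker = k at *
    have hle := Nat.le_of_dvd (by norm_num) hd
    interval_cases k <;> omega
  obtain ⟨f, hf⟩ := embed_of_sylow 3 4 h4 hk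
  rcases hc with hc | hc
  · left; exact alt_of_embed 4 f hf (by rw [hc]; rfl)
  · right; exact sym_of_embed 4 f hf (by rw [hc]; rfl)

theorem icosa {G : Type*} [Group G] [Finite G] (hc : Nat.card G = 60)
    (hn : ∀ K : Subgroup G, K.Normal → ¬ (Nat.card K).Prime)
    (h4 : ∀ g : G, g ^ 4 = 1 → g * g = 1)
    (hcent : ∀ t : G, t ≠ 1 → t * t = 1 → Nat.card (Subgroup.centralizer {t}) ≤ 4)
    (hconj : ∀ t s : G, t ≠ 1 → t * t = 1 → s ≠ 1 → s * s = 1 → IsConj t s) :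
    Nonempty (G ≃* alternatingGroup (Fin 5)) := by
  have : Fact (Nat.Prime 2) := ⟨Nat.prime_two⟩
  have f60 : (60 : ℕ).factorization 2 = 2 := by
    rw [show 60 = 2 ^ 2 * 15 by norm_num, Nat.factorization_mul (by norm_num) (by norm_num), Nat.Prime.factorization_pow Nat.prime_two]
    simp [Nat.factorization_eq_zero_of_not_dvd]
  have hP : ∀ P : Sylow 2 G, Nat.card P = 4 := by
    intro P
    rw [P.card_eq_multiplicity, hc, f60]; norm_num
  have hsq : ∀ (P : Sylow 2 G), ∀ x ∈ P, x * x = 1 := by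
    intro P x hx
    apply h4
    have := pow_card_eq_one' (G := P) (x := ⟨x, hx⟩)
    rw [hP P] at this
    simpa using congrArg Subtype.val this
  have hPC : ∀ (P : Sylow 2 G), ∀ t ∈ P, t ≠ 1 → (P : Subgroup G) = Subgroup.centralizer {t} := by
    intro P t ht ht1
    apply Subgroup.eq_of_le_of_card_ge
    · intro x hx
      rw [Subgroup.mem_centralizer_singleton_iff]
      have a := hsq P x hx
      have b := hsq P t ht
      have c := hsq P (x * t) (P.mul_mem hx ht)
      have e1 := inv_eq_of_mul_eq_one_left a
      have e2 := inv_eq_of_mul_eq_one_left b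
      have e3 := inv_eq_of_mul_eq_one_left c
      rw [mul_inv_rev, e1, e2] at e3
      first | exact e3 | exact e3.symm
    · rw [show Nat.card (P : Subgroup G) = 4 from hP P]
      exact hcent t ht1 (hsq P t ht)
  -- an involution
  obtain ⟨t0, ht0⟩ := exists_prime_orderOf_dvd_card' (G := G) 2 (by rw [hc]; norm_num)
  have ht01 : t0 ≠ 1 := by rintro rfl; simp at ht0
  have ht0s : t0 * t0 = 1 := by rw [← sq, ← ht0, pow_orderOf_eq_one]
  have hin : ∀ t : G, t ≠ 1 → t * t = 1 → ∃ P : Sylow 2 G, t ∈ P := by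
    intro t h1 h2
    have hp : IsPGroup 2 (Subgroup.zpowers t) :=
      IsPGroup.of_card (n := 1) (by
        rw [Nat.card_zpowers, pow_one]; exact orderOf_eq_prime (by rw [sq, h2]) h1)
    obtain ⟨Q, hQ⟩ := hp.exists_le_sylow
    exact ⟨Q, hQ (Subgroup.mem_zpowers t)⟩
  have hI : Nat.card {t : G // t ≠ 1 ∧ t * t = 1} = 15 := by
    obtain ⟨P, hPt⟩ := hin t0 ht01 ht0s
    have e1 := orb_stab (G := ConjAct G) t0
    have e2 : Nat.card (MulAction.stabilizer (ConjAct G) t0) = 4 := by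
      rw [ConjAct.stabilizer_eq_centralizer]
      have := hP P
      rw [hPC P t0 hPt ht01] at this
      exact this
    have e3 : Nat.card (MulAction.orbit (ConjAct G) t0)
        = Nat.card {t : G // t ≠ 1 ∧ t * t = 1} := by
      apply Nat.card_congr
      apply Equiv.subtypeEquivRight
      intro s
      rw [ConjAct.mem_orbit_conjAct]
      constructor
      · intro h
        obtain ⟨c, hc⟩ := isConj_iff.1 h.symm
        subst hc
        refine ⟨fun h => ht01 (by simpa using h), ?_⟩
        simp [ht0s]
      · rintro ⟨h1, h2⟩
        exact hconj _ _ h1 h2 ht01 ht0s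
    have e4 : Nat.card (ConjAct G) = 60 := hc
    rw [e2, e3, e4] at e1
    omega
  have hcount : Nat.card {t : G // t ≠ 1 ∧ t * t = 1} = 3 * Nat.card (Sylow 2 G) := by
    let F : (Σ P : Sylow 2 G, {t : P // t ≠ 1}) → {t : G // t ≠ 1 ∧ t * t = 1} :=
      fun x => ⟨x.2.1.1, fun h => x.2.2 (Subtype.ext h), hsq x.1 _ x.2.1.2⟩
    have hF : Function.Bijective F := by
      constructor
      · rintro ⟨P, ⟨t, ht⟩, ht1⟩ ⟨Q, ⟨s, hs⟩, hs1⟩ hEq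
        have hts : t = s := congrArg Subtype.val hEq
        subst hts
        have ht1' : t ≠ 1 := fun h => ht1 (Subtype.ext h)
        have : P = Q := Sylow.ext ((hPC P t ht ht1').trans (hPC Q t hs ht1').symm)
        subst this
        rfl
      · rintro ⟨t, h1, h2⟩
        obtain ⟨P, hP⟩ := hin t h1 h2
        exact ⟨⟨P, ⟨t, hP⟩, fun h => h1 (congrArg Subtype.val h)⟩, rfl⟩
    have := Fintype.ofFinite (Sylow 2 G)
    rw [← Nat.card_congr (Equiv.ofBijective F hF), Nat.card_sigma]
    have : ∀ P : Sylow 2 G, Nat.card {t : P // t ≠ 1} = 3 := by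
      intro P
      have := Fintype.ofFinite P
      classical
      rw [Nat.card_eq_fintype_card, Fintype.card_subtype_compl, Fintype.card_subtype_eq,
        ← Nat.card_eq_fintype_card]
      exact congrArg (· - 1) (hP P)
    simp [this, mul_comm]
  have h5 : Nat.card (Sylow 2 G) = 5 := by omega
  have hk : Nat.card (MulAction.toPermHom G (Sylow 2 G)).ker = 1 := by
    have hd := ker_dvd (G := G) 2
    rw [h5, hc] at hd
    have hd : Nat.card (MulAction.toPermHom G (Sylow 2 G)).ker ∣ 12 :=
      Nat.dvd_of_mul_dvd_mul_right (k := 5) (by norm_num) hd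
    have n2 : ¬ 2 ∣ Nat.card (MulAction.toPermHom G (Sylow 2 G)).ker := by
      intro h
      obtain ⟨g, hgo, hg⟩ := mem_all_sylow 2 h
      have hg1 : g ≠ 1 := by rintro rfl; simp at hgo
      have : Subsingleton (Sylow 2 G) :=
        ⟨fun A B => Sylow.ext ((hPC A g (hg A) hg1).trans (hPC B g (hg B) hg1).symm)⟩
      have := Finite.card_le_one_iff_subsingleton.2 this
      omega
    have n3 : Nat.card (MulAction.toPermHom G (Sylow 2 G)).ker ≠ 3 := by
      intro h
      refine hn (MulAction.toPermHom G (Sylow 2 G)).ker (MonoidHom.normal_ker _) ?_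
      rw [h]; exact Nat.prime_three
    generalize Nat.card (MulAction.toPermHom G (Sylow 2 G)).ker = k at *
    have hle := Nat.le_of_dvd (by norm_num) hd
    interval_cases k <;> omega
  obtain ⟨f, hf⟩ := embed_of_sylow 2 5 h5 hk
  exact alt_of_embed 5 f hf (by rw [hc]; rfl)

section core
open MulAction

theorem stab_card_eq {G X : Type*} [Group G] [Finite G] [MulAction G X] {x a : X}
    (h : x ∈ orbit G a) : Nat.card (stabilizer G x) = Nat.card (stabilizer G a) := by
  have h1 := orb_stab (G := G) x
  have h2 := orb_stab (G := G) a
  rw [orbit_eq_iff.2 h] at h1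
  have : 0 < Nat.card (orbit G a) := by
    rcases Nat.eq_zero_or_pos (Nat.card (orbit G a)) with h | h
    · rw [h] at h2; have : 0 < Nat.card G := Nat.card_pos
      omega
    · exact h
  exact Nat.eq_of_mul_eq_mul_left this (h1.trans h2.symm)

theorem eq_of_card_two {G : Type*} [Group G] (S : Subgroup G) (hS : Nat.card S = 2) {t s : G}
    (ht : t ∈ S) (hs : s ∈ S) (ht1 : t ≠ 1) (hs1 : s ≠ 1) : t = s := by
  obtain ⟨a, b, hab, hu⟩ := (Nat.card_eq_two_iff).1 hS
  have key : ∀ z : S, z = a ∨ z = b := by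
    intro z
    have : z ∈ ({a, b} : Set S) := by rw [hu]; trivial
    simpa using this
  have k1 := key ⟨t, ht⟩
  have k2 := key ⟨s, hs⟩
  have k3 := key 1
  have n1 : (⟨t, ht⟩ : S) ≠ 1 := fun h => ht1 (congrArg Subtype.val h)
  have n2 : (⟨s, hs⟩ : S) ≠ 1 := fun h => hs1 (congrArg Subtype.val h)
  have : (⟨t, ht⟩ : S) = ⟨s, hs⟩ := by grind
  exact congrArg Subtype.val this

theorem finish {G X : Type*} [Group G] [Finite G] [Finite X] [MulAction G X]
    (h2 : ∀ g : G, g ≠ 1 → Nat.card (fixedBy X g) = 2)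
    (hs : ∀ x : X, 2 ≤ Nat.card (stabilizer G x)) (hc : ∀ x : X, IsCyclic (stabilizer G x))
    (a b c : X) (hcov : ∀ x : X, x ∈ orbit G a ∨ x ∈ orbit G b ∨ x ∈ orbit G c)
    (hsum : Nat.card (orbit G a) + Nat.card (orbit G b) + Nat.card (orbit G c) = Nat.card G + 2)
    (hab : Nat.card (stabilizer G a) ≤ Nat.card (stabilizer G b))
    (hbc : Nat.card (stabilizer G b) ≤ Nat.card (stabilizer G c)) :
    (∃ n : ℕ, Nonempty (G ≃* DihedralGroup n)) ∨
      Nonempty (G ≃* alternatingGroup (Fin 4)) ∨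
      Nonempty (G ≃* Equiv.Perm (Fin 4)) ∨
      Nonempty (G ≃* alternatingGroup (Fin 5)) := by
  have hfix : ∀ g : G, g ≠ 1 → ∃ x : X, g • x = x := by
    intro g hg
    have : 0 < Nat.card (fixedBy X g) := by rw [h2 g hg]; norm_num
    obtain ⟨⟨x, hx⟩⟩ := (Nat.card_pos_iff.1 this).1
    exact ⟨x, hx⟩
  have hnorm : (∀ x : X, 2 * Nat.card (stabilizer G x) < Nat.card G) →
      ∀ K : Subgroup G, K.Normal → ¬ (Nat.card K).Prime := by
    intro hlt K hK hp
    have : Fact (Nat.card K).Prime := ⟨hp⟩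
    have : Nontrivial K := Finite.one_lt_card_iff_nontrivial.1 hp.one_lt
    obtain ⟨g, hg⟩ := exists_ne (1 : K)
    have hg1 : (g : G) ≠ 1 := fun h => hg (Subtype.ext h)
    obtain ⟨x, hx⟩ := hfix g hg1
    have hall : ∀ k ∈ K, k • x = x := by
      intro k hk
      have h1 : (⟨k, hk⟩ : K) ∈ Subgroup.zpowers g := mem_zpowers_of_prime_card rfl hg
      obtain ⟨z, hz⟩ := h1
      have hz : (g : G) ^ z = k := by simpa using congrArg Subtype.val hz
      rw [← hz]
      exact (stabilizer G x).zpow_mem (show (g : G) ∈ stabilizer G x from hx) z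
    have hsub : orbit G x ⊆ fixedBy X (g : G) := by
      rintro _ ⟨h, rfl⟩
      have := hall (h⁻¹ * g * h) (by simpa using hK.conj_mem g g.2 h⁻¹)
      show (g : G) • h • x = h • x
      rw [mul_smul, mul_smul, inv_smul_eq_iff] at this
      exact this
    have h3 := Nat.card_mono (Set.toFinite _) hsub
    rw [h2 _ hg1] at h3
    have h4 := orb_stab (G := G) x
    have h5 := hlt x
    nlinarith
  have hcard : ∀ x : X, Nat.card (stabilizer G x) = Nat.card (stabilizer G a) ∨
      Nat.card (stabilizer G x) = Nat.card (stabilizer G b) ∨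
      Nat.card (stabilizer G x) = Nat.card (stabilizer G c) := by
    intro x
    rcases hcov x with h | h | h
    · exact Or.inl (stab_card_eq h)
    · exact Or.inr (Or.inl (stab_card_eq h))
    · exact Or.inr (Or.inr (stab_card_eq h))
  have hpow : ∀ (g : G) (x : X), g • x = x → g ^ Nat.card (stabilizer G x) = 1 := by
    intro g x hx
    have := pow_card_eq_one' (G := stabilizer G x) (x := ⟨g, hx⟩)
    simpa using congrArg Subtype.val this
  rcases numbers _ _ _ _ _ _ _ (orb_stab (G := G) a) (orb_stab (G := G) b) (orb_stab (G := G) c)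
    (hs a) (hs b) (hs c) hab hbc hsum with ⟨ea, eb, eN⟩ | ⟨ea, eb, ec, eN⟩ | ⟨ea, eb, ec, eN⟩ |
      ⟨ea, eb, ec, eN⟩
  · left
    have := hc c
    refine ⟨_, dihedral_of (stabilizer G c) eN ?_⟩
    intro g hg
    have hg1 : g ≠ 1 := by rintro rfl; exact hg (Subgroup.one_mem _)
    obtain ⟨x, hx⟩ := hfix g hg1
    have hor : Nat.card (stabilizer G x) = 2 ∨ x ∈ orbit G c := by
      rcases hcov x with h | h | h
      · exact Or.inl ((stab_card_eq h).trans ea)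
      · exact Or.inl ((stab_card_eq h).trans eb)
      · exact Or.inr h
    rcases hor with h | ⟨k, hk⟩
    · have := hpow g x hx
      rwa [h, sq] at this
    · exfalso
      have hk : k • c = x := hk
      have hi : (stabilizer G c).index = 2 := by
        have := (stabilizer G c).card_mul_index
        have := hs c
        nlinarith
      have hN := Subgroup.normal_of_index_eq_two hi
      apply hg
      have h1 : k⁻¹ * g * k ∈ stabilizer G c := by
        rw [mem_stabilizer_iff, mul_smul, mul_smul, hk, hx, ← hk, inv_smul_smul]
      have := hN.conj_mem _ h1 k
      have e : k * (k⁻¹ * g * k) * k⁻¹ = g := by group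
      rwa [e] at this
  · right
    rcases octa (Or.inl eN) (hnorm (by intro x; have := hcard x; omega)) with h | h
    · exact Or.inl h
    · exact Or.inr (Or.inl h)
  · right
    rcases octa (Or.inr eN) (hnorm (by intro x; have := hcard x; omega)) with h | h
    · exact Or.inl h
    · exact Or.inr (Or.inl h)
  · right; right; right
    have hinv : ∀ (t : G) (x : X), t ≠ 1 → t * t = 1 → t • x = x →
        Nat.card (stabilizer G x) = 2 ∧ x ∈ orbit G a := by
      intro t x ht htt hx
      have hp := hpow t x hx
      have no : ∀ y, x ∈ orbit G y → (Nat.card (stabilizer G y) = 3 ∨ Nat.card (stabilizer G y) = 5)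
          → False := by
        intro y hy hor
        rw [stab_card_eq hy] at hp
        apply ht
        rcases hor with h | h <;> rw [h] at hp
        · simpa [pow_succ, htt] using hp
        · simpa [pow_succ, htt] using hp
      rcases hcov x with h | h | h
      · exact ⟨(stab_card_eq h).trans ea, h⟩
      · exact (no b h (Or.inl eb)).elim
      · exact (no c h (Or.inr ec)).elim
    refine icosa eN (hnorm (by intro x; have := hcard x; omega)) ?_ ?_ ?_
    · intro g hg
      by_cases hg1 : g = 1
      · simp [hg1]
      obtain ⟨x, hx⟩ := hfix g hg1
      have hp := hpow g x hx
      have := hcard x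
      rw [ea, eb, ec] at this
      rcases this with h | h | h <;> rw [h] at hp
      · rwa [sq] at hp
      · have : g = 1 := by rw [pow_succ, hp, one_mul] at hg; exact hg
        exact absurd this hg1
      · have : g = 1 := by rw [pow_succ, hg, one_mul] at hp; exact hp
        exact absurd this hg1
    · intro t ht htt
      obtain ⟨x, hx⟩ := hfix t ht
      obtain ⟨hx2, -⟩ := hinv t x ht htt hx
      rw [← orb_stab (G := Subgroup.centralizer {t}) x]
      have h1 : Nat.card (orbit (Subgroup.centralizer {t}) x) ≤ 2 := by
        rw [← h2 t ht]
        apply Nat.card_mono (Set.toFinite _)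
        rintro _ ⟨⟨k, hk⟩, rfl⟩
        rw [Subgroup.mem_centralizer_singleton_iff] at hk
        show t • k • x = k • x
        rw [← mul_smul, ← hk, mul_smul, hx]
      have h3 : Nat.card (stabilizer (Subgroup.centralizer {t}) x) ≤ 2 := by
        rw [← hx2]
        apply Nat.card_le_card_of_injective
          (fun k : stabilizer (Subgroup.centralizer {t}) x => (⟨k.1.1, k.2⟩ : stabilizer G x))
        intro k l hkl
        exact Subtype.ext (Subtype.ext (congrArg (fun z : stabilizer G x => z.1) hkl))
      nlinarith
    · intro t s ht htt hs1 hss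
      obtain ⟨x, hx⟩ := hfix t ht
      obtain ⟨y, hy⟩ := hfix s hs1
      obtain ⟨hx2, hxa⟩ := hinv t x ht htt hx
      obtain ⟨hy2, hya⟩ := hinv s y hs1 hss hy
      rw [← orbit_eq_iff.2 hxa] at hya
      obtain ⟨k, hk⟩ := hya
      have hk : k • x = y := hk
      rw [isConj_iff]
      refine ⟨k, eq_of_card_two _ hy2 ?_ hy ?_ hs1⟩
      · rw [mem_stabilizer_iff, mul_smul, mul_smul, ← hk, inv_smul_smul, hx]
      · intro h; exact ht (by simpa using h)

theorem core {G X : Type*} [Group G] [Finite G] [Finite X] [MulAction G X]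
    (h2 : ∀ g : G, g ≠ 1 → Nat.card (fixedBy X g) = 2)
    (hs : ∀ x : X, stabilizer G x ≠ ⊥) (hc : ∀ x : X, IsCyclic (stabilizer G x)) :
    IsCyclic G ∨ (∃ n : ℕ, Nonempty (G ≃* DihedralGroup n)) ∨
      Nonempty (G ≃* alternatingGroup (Fin 4)) ∨
      Nonempty (G ≃* Equiv.Perm (Fin 4)) ∨
      Nonempty (G ≃* alternatingGroup (Fin 5)) := by
  classical
  have hs : ∀ x : X, 2 ≤ Nat.card (stabilizer G x) := fun x =>
    (Subgroup.one_lt_card_iff_ne_bot _).2 (hs x)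
  by_cases hN1 : Nat.card G = 1
  · left
    have := (Nat.card_eq_one_iff_unique.1 hN1).1
    infer_instance
  have hN : 2 ≤ Nat.card G := by
    have : 0 < Nat.card G := Nat.card_pos
    omega
  have := Fintype.ofFinite G
  have := Fintype.ofFinite X
  let Ω := Quotient (orbitRel G X)
  have : Fintype Ω := Fintype.ofFinite Ω
  have hb := sum_card_fixedBy_eq_card_orbits_mul_card_group G X
  have hb2 : Nat.card X + 2 * (Nat.card G - 1) = Nat.card Ω * Nat.card G := by
    rw [Nat.card_eq_fintype_card (α := Ω), Nat.card_eq_fintype_card (α := G)]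
    refine Eq.trans ?_ hb
    rw [← Finset.add_sum_erase _ _ (Finset.mem_univ (1 : G))]
    have e1 : Fintype.card (fixedBy X (1 : G)) = Nat.card X := by
      rw [← Nat.card_eq_fintype_card, fixedBy_one_eq_univ]; simp
    rw [e1, Finset.sum_congr rfl (g := fun _ => 2) (by
      intro g hg
      rw [← Nat.card_eq_fintype_card]; exact h2 g (Finset.ne_of_mem_erase hg))]
    simp [Finset.card_erase_of_mem, mul_comm]
  have hX : Nat.card X = ∑ ω : Ω, Nat.card (orbit G ω.out) := by
    rw [Nat.card_congr (selfEquivSigmaOrbits G X), Nat.card_sigma]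
  have hm : ∀ x : X, 2 * Nat.card (orbit G x) ≤ Nat.card G := by
    intro x
    have := orb_stab (G := G) x
    have := hs x
    nlinarith
  have hpos : ∀ x : X, 1 ≤ Nat.card (orbit G x) := by
    intro x
    rcases Nat.eq_zero_or_pos (Nat.card (orbit G x)) with h | h
    · have := orb_stab (G := G) x
      rw [h] at this; omega
    · exact h
  have hX2 : 2 * Nat.card X ≤ Nat.card Ω * Nat.card G := by
    rw [hX, Finset.mul_sum]
    refine (Finset.sum_le_sum (g := fun _ => Nat.card G) fun ω _ => hm _).trans ?_
    simp
  have hr : Nat.card Ω ≤ 3 := by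
    by_contra h
    push Not at h
    have : 4 * Nat.card G ≤ Nat.card Ω * Nat.card G := Nat.mul_le_mul_right _ h
    omega
  obtain ⟨r, hr'⟩ : ∃ r, Nat.card Ω = r := ⟨_, rfl⟩
  let e : Ω ≃ Fin r := Finite.equivFinOfCardEq hr'
  have hX3 : Nat.card X = ∑ i : Fin r, Nat.card (orbit G (e.symm i).out) := by
    rw [hX]
    exact (Equiv.sum_comp e.symm (fun ω : Ω => Nat.card (orbit G ω.out))).symm
  have hcov : ∀ x : X, ∃ i : Fin r, x ∈ orbit G (e.symm i).out := by
    intro x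
    refine ⟨e (Quotient.mk _ x), ?_⟩
    rw [Equiv.symm_apply_apply]
    exact Setoid.symm' _ (Quotient.mk_out (s := orbitRel G X) x)
  rw [hr'] at hr hb2
  generalize hf : (fun i => (e.symm i).out) = f at *
  have hf' : ∀ i, (e.symm i).out = f i := fun i => congrFun hf i
  simp only [hf'] at hX3 hcov
  clear hf hf' e hr'
  interval_cases r
  · simp at hX3; omega
  · rw [Fin.sum_univ_one] at hX3
    have := hpos (f 0)
    omega
  · left
    rw [Fin.sum_univ_two] at hX3
    have a1 := hpos (f 0)
    have a2 := hpos (f 1)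
    have a3 : Nat.card (orbit G (f 0)) = 1 := by omega
    have a4 := orb_stab (G := G) (f 0)
    rw [a3, one_mul] at a4
    have a5 : stabilizer G (f 0) = ⊤ := Subgroup.eq_top_of_card_eq _ a4
    have a6 := hc (f 0)
    rw [a5] at a6
    exact (Subgroup.topEquiv (G := G)).isCyclic.1 a6
  · right
    rw [Fin.sum_univ_three] at hX3
    have hcov' : ∀ x : X, x ∈ orbit G (f 0) ∨ x ∈ orbit G (f 1) ∨ x ∈ orbit G (f 2) := by
      intro x
      obtain ⟨i, hi⟩ := hcov x
      fin_cases i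
      · exact Or.inl hi
      · exact Or.inr (Or.inl hi)
      · exact Or.inr (Or.inr hi)
    have F := finish h2 hs hc
    have hsum : Nat.card (orbit G (f 0)) + Nat.card (orbit G (f 1)) + Nat.card (orbit G (f 2))
      = Nat.card G + 2 := by omega
    generalize f 0 = a at *
    generalize f 1 = b at *
    generalize f 2 = c at *
    rcases le_total (Nat.card (stabilizer G a)) (Nat.card (stabilizer G b)) with h1 | h1 <;>
    rcases le_total (Nat.card (stabilizer G b)) (Nat.card (stabilizer G c)) with h3 | h3 <;>
    rcases le_total (Nat.card (stabilizer G a)) (Nat.card (stabilizer G c)) with h4 | h4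
    · exact F a b c (fun x => by have := hcov' x; tauto) (by omega) h1 h3
    · exact F a b c (fun x => by have := hcov' x; tauto) (by omega) h1 h3
    · exact F a c b (fun x => by have := hcov' x; tauto) (by omega) h4 h3
    · exact F c a b (fun x => by have := hcov' x; tauto) (by omega) h4 h1
    · exact F b a c (fun x => by have := hcov' x; tauto) (by omega) h1 h4
    · exact F b c a (fun x => by have := hcov' x; tauto) (by omega) h3 h4
    · exact F c b a (fun x => by have := hcov' x; tauto) (by omega) h3 h1
    · exact F c b a (fun x => by have := hcov' x; tauto) (by omega) h3 h1

/-- Version on a possibly infinite set. -/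
theorem core' {G X : Type*} [Group G] [Finite G] [MulAction G X]
    (h2 : ∀ g : G, g ≠ 1 → Nat.card (fixedBy X g) = 2)
    (hc : ∀ x : X, IsCyclic (stabilizer G x)) :
    IsCyclic G ∨ (∃ n : ℕ, Nonempty (G ≃* DihedralGroup n)) ∨
      Nonempty (G ≃* alternatingGroup (Fin 4)) ∨
      Nonempty (G ≃* Equiv.Perm (Fin 4)) ∨
      Nonempty (G ≃* alternatingGroup (Fin 5)) := by
  let Y : SubMulAction G X :=
    { carrier := {x | ∃ g : G, g ≠ 1 ∧ g • x = x}
      smul_mem' := by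
        rintro k x ⟨g, hg, hx⟩
        refine ⟨k * g * k⁻¹, fun h => hg (by simpa using h), ?_⟩
        rw [mul_smul, mul_smul, inv_smul_smul, hx] }
  have hmemY : ∀ x, x ∈ Y ↔ ∃ g : G, g ≠ 1 ∧ g • x = x := fun x => Iff.rfl
  have hfin : Finite Y := by
    have : (Y : Set X) ⊆ ⋃ g : {g : G // g ≠ 1}, fixedBy X g.1 := by
      rintro x ⟨g, hg, hx⟩
      exact Set.mem_iUnion.2 ⟨⟨g, hg⟩, hx⟩
    refine Set.Finite.subset (Set.finite_iUnion fun g => ?_) this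
    have : 0 < Nat.card (fixedBy X g.1) := by rw [h2 g.1 g.2]; norm_num
    exact (Nat.card_pos_iff.1 this).2
  refine core (X := Y) ?_ ?_ ?_
  · intro g hg
    rw [← h2 g hg]
    refine Nat.card_congr ⟨fun y => ⟨y.1.1, congrArg Subtype.val y.2⟩,
      fun x => ⟨⟨x.1, g, hg, x.2⟩, Subtype.ext x.2⟩, fun _ => rfl, fun _ => rfl⟩
  · rintro ⟨x, g, hg, hx⟩ hbot
    have : g ∈ stabilizer G (⟨x, g, hg, hx⟩ : Y) := Subtype.ext hx
    rw [hbot] at this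
    exact hg this
  · intro y
    rw [SubMulAction.stabilizer_of_subMul]
    exact hc y.1

end core

section geom
open Matrix

variable {k : Type*} [Field k]

theorem mem_center_iff' (A : GL (Fin 2) k) :
    A ∈ Subgroup.center (GL (Fin 2) k) ↔ A 0 1 = 0 ∧ A 1 0 = 0 ∧ A 0 0 = A 1 1 := by
  rw [Matrix.GeneralLinearGroup.mem_center_iff_val_mem_range_scalar]
  constructor
  · rintro ⟨r, hr⟩
    rw [← hr]
    simp
  · rintro ⟨h1, h2, h3⟩
    refine ⟨A 0 0, ?_⟩
    ext i j
    fin_cases i <;> fin_cases j <;> simp [h1, h2, h3]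

/-- discriminant -/
def dsc (A : GL (Fin 2) k) : k := (A 0 0 - A 1 1) ^ 2 + 4 * (A 0 1 * A 1 0)

theorem det_eq (A : GL (Fin 2) k) : A 0 0 * A 1 1 - A 0 1 * A 1 0 ≠ 0 := by
  rw [← Matrix.det_fin_two]; exact A.det_ne_zero

theorem dsc_ne_zero (A : GL (Fin 2) k) (h2 : (2 : k) ≠ 0) (hA : A ∉ Subgroup.center (GL (Fin 2) k))
    (n : ℕ) (hn : (n : k) ≠ 0) (hAn : A ^ n ∈ Subgroup.center (GL (Fin 2) k)) : dsc A ≠ 0 := by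
  intro hd
  unfold dsc at hd
  have hdet := det_eq A
  set a := A 0 0 with ha
  set b := A 0 1 with hb
  set c := A 1 0 with hc
  set d := A 1 1 with hd'
  obtain ⟨l, hl⟩ : ∃ l : k, a + d = 2 * l := ⟨(a + d) / 2, by field_simp⟩
  have hld : l ^ 2 = a * d - b * c := by
    have : (2 : k) ^ 2 * (l ^ 2 - (a * d - b * c)) = 0 := by
      have : (a + d) ^ 2 = 4 * l ^ 2 := by rw [hl]; ring
      linear_combination -this + hd
    have := (mul_eq_zero.1 this).resolve_left (pow_ne_zero 2 h2)
    linear_combination this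
  have hl0 : l ≠ 0 := by rintro rfl; apply hdet; rw [← hld]; ring
  have key : ∀ m : ℕ, l * ((A ^ m : GL (Fin 2) k) 0 0) = l ^ m * (l + m * (a - l)) ∧
      l * ((A ^ m : GL (Fin 2) k) 0 1) = l ^ m * (m * b) ∧
      l * ((A ^ m : GL (Fin 2) k) 1 0) = l ^ m * (m * c) ∧
      l * ((A ^ m : GL (Fin 2) k) 1 1) = l ^ m * (l + m * (d - l)) := by
    intro m
    induction m with
    | zero => simp
    | succ m ih =>
      obtain ⟨i1, i2, i3, i4⟩ := ih
      have e : ∀ i j, (A ^ (m + 1) : GL (Fin 2) k) i j =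
          (A ^ m : GL (Fin 2) k) i 0 * A 0 j + (A ^ m : GL (Fin 2) k) i 1 * A 1 j := by
        intro i j
        rw [pow_succ, Units.val_mul, Matrix.mul_apply, Fin.sum_univ_two]
      simp only [e, ← ha, ← hb, ← hc, ← hd']
      have ed : d = 2 * l - a := by linear_combination hl
      have ebc : b * c = a * (2 * l - a) - l ^ 2 := by rw [← ed]; linear_combination hld
      push_cast
      refine ⟨?_, ?_, ?_, ?_⟩
      · linear_combination a * i1 + c * i2 + l ^ m * m * ebc
      · rw [ed]
        linear_combination b * i1 + (2 * l - a) * i2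
      · rw [ed] at i4
        linear_combination a * i3 + c * i4
      · rw [ed] at i4 ⊢
        linear_combination b * i3 + (2 * l - a) * i4 + l ^ m * m * ebc
  rw [mem_center_iff'] at hAn hA
  obtain ⟨k1, k2, k3, k4⟩ := key n
  obtain ⟨z1, z2, z3⟩ := hAn
  rw [z1] at k2
  rw [z2] at k3
  have hln : l ^ n ≠ 0 := pow_ne_zero _ hl0
  apply hA
  refine ⟨?_, ?_, ?_⟩
  · have : l ^ n * (n * b) = 0 := by rw [← k2]; ring
    simpa [hln, hn] using this
  · have : l ^ n * (n * c) = 0 := by rw [← k3]; ring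
    simpa [hln, hn] using this
  · have : l ^ n * (n * (a - d)) = 0 := by
      rw [z3] at k1
      linear_combination k4 - k1
    have : a - d = 0 := by simpa [hln, hn] using this
    linear_combination this

variable [DecidableEq k]

theorem fix_some (A : GL (Fin 2) k) (x : k) : A • (x : OnePoint k) = x ↔
    A 1 0 * x ^ 2 + (A 1 1 - A 0 0) * x - A 0 1 = 0 := by
  rw [← Matrix.GeneralLinearGroup.fixpointPolynomial_aeval_eq_zero_iff]
  simp [Matrix.GeneralLinearGroup.fixpointPolynomial]

theorem center_smul (A : GL (Fin 2) k) (hA : A ∈ Subgroup.center (GL (Fin 2) k)) (x : OnePoint k) :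
    A • x = x := by
  rw [mem_center_iff'] at hA
  obtain ⟨h1, h2, h3⟩ := hA
  cases x with
  | infty => rw [OnePoint.smul_infty_eq_self_iff]; exact h2
  | coe x => rw [fix_some, h1, h2, h3]; ring

theorem two_fixed [IsAlgClosed k] (A : GL (Fin 2) k) (h2 : (2 : k) ≠ 0) (hd : dsc A ≠ 0) :
    Nat.card {x : OnePoint k // A • x = x} = 2 := by
  suffices h : ∃ p q : OnePoint k, p ≠ q ∧ ∀ x, A • x = x ↔ x = p ∨ x = q by
    obtain ⟨p, q, hpq, h⟩ := h
    have : {x : OnePoint k | A • x = x} = {p, q} := by ext x; simp [h]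
    show Nat.card ({x : OnePoint k | A • x = x} : Set _) = 2
    rw [this, Nat.card_coe_set_eq, Set.ncard_pair hpq]
  unfold dsc at hd
  by_cases hc : A 1 0 = 0
  · have had : A 1 1 - A 0 0 ≠ 0 := by
      intro h; apply hd; rw [hc]; linear_combination (A 1 1 - A 0 0) * h
    refine ⟨OnePoint.infty, ((A 0 1 / (A 1 1 - A 0 0) : k) : OnePoint k), OnePoint.infty_ne_coe _, ?_⟩
    intro x
    cases x with
    | infty => simp [OnePoint.smul_infty_eq_self_iff, hc]
    | coe x =>
      rw [fix_some, hc, OnePoint.coe_eq_coe, eq_div_iff had]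
      simp only [OnePoint.coe_ne_infty, false_or]
      constructor <;> intro h <;> linear_combination h
  · obtain ⟨s, hs⟩ := IsAlgClosed.exists_pow_nat_eq
      ((A 0 0 - A 1 1) ^ 2 + 4 * (A 0 1 * A 1 0)) (n := 2) (by norm_num)
    have hs0 : s ≠ 0 := by rintro rfl; apply hd; rw [← hs]; ring
    have h2c : 2 * A 1 0 ≠ 0 := mul_ne_zero h2 hc
    refine ⟨(((A 0 0 - A 1 1 + s) / (2 * A 1 0) : k) : OnePoint k),
      (((A 0 0 - A 1 1 - s) / (2 * A 1 0) : k) : OnePoint k), ?_, ?_⟩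
    · rw [Ne, OnePoint.coe_eq_coe, div_left_inj' h2c]
      intro h
      have : 2 * s = 0 := by linear_combination h
      exact mul_ne_zero h2 hs0 this
    · intro x
      cases x with
      | infty => simp [OnePoint.smul_infty_eq_self_iff, hc]
      | coe x =>
        rw [fix_some, OnePoint.coe_eq_coe, OnePoint.coe_eq_coe, eq_div_iff h2c, eq_div_iff h2c]
        have e : 4 * A 1 0 * (A 1 0 * x ^ 2 + (A 1 1 - A 0 0) * x - A 0 1) =
          (x * (2 * A 1 0) - (A 0 0 - A 1 1 + s)) * (x * (2 * A 1 0) - (A 0 0 - A 1 1 - s)) := by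
          linear_combination hs
        have h4c : 4 * A 1 0 ≠ 0 := by
          have : (4 : k) = 2 * 2 := by norm_num
          rw [this]; exact mul_ne_zero (mul_ne_zero h2 h2) hc
        rw [← sub_eq_zero (b := A 0 0 - A 1 1 + s), ← sub_eq_zero (b := A 0 0 - A 1 1 - s),
          ← mul_eq_zero, ← e, mul_eq_zero, or_iff_right h4c]

/-- eigenvalue at a fixed point -/
def eig (A : GL (Fin 2) k) (x : OnePoint k) : k :=
  x.elim (A 0 0) (fun t => A 1 0 * t + A 1 1)

/-- multiplier at a fixed point -/
def chi (x : OnePoint k) (A : GL (Fin 2) k) : k :=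
  eig A x ^ 2 / (A 0 0 * A 1 1 - A 0 1 * A 1 0)

theorem eig_mul (A B : GL (Fin 2) k) (x : OnePoint k) (hA : A • x = x) (hB : B • x = x) :
    eig (A * B) x = eig A x * eig B x := by
  have e : ∀ i j, (A * B : GL (Fin 2) k) i j = A i 0 * B 0 j + A i 1 * B 1 j := by
    intro i j
    rw [Units.val_mul, Matrix.mul_apply, Fin.sum_univ_two]
  cases x with
  | infty =>
    rw [OnePoint.smul_infty_eq_self_iff] at hA hB
    show (A * B : GL (Fin 2) k) 0 0 = A 0 0 * B 0 0
    rw [e, hB]; ring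
  | coe x =>
    rw [fix_some] at hA hB
    show (A * B : GL (Fin 2) k) 1 0 * x + (A * B : GL (Fin 2) k) 1 1 =
      (A 1 0 * x + A 1 1) * (B 1 0 * x + B 1 1)
    rw [e, e]
    linear_combination (-A 1 0) * hB

theorem chi_mul (A B : GL (Fin 2) k) (x : OnePoint k) (hA : A • x = x) (hB : B • x = x) :
    chi x (A * B) = chi x A * chi x B := by
  unfold chi
  rw [eig_mul A B x hA hB, ← Matrix.det_fin_two, ← Matrix.det_fin_two, ← Matrix.det_fin_two,
    Units.val_mul, Matrix.det_mul]
  ring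

theorem chi_center (A : GL (Fin 2) k) (x : OnePoint k) (hA : A ∈ Subgroup.center (GL (Fin 2) k)) :
    chi x A = 1 := by
  have hd := det_eq A
  rw [mem_center_iff'] at hA
  obtain ⟨h1, h2, h3⟩ := hA
  unfold chi
  rw [div_eq_one_iff_eq hd]
  cases x with
  | infty => show A 0 0 ^ 2 = _; rw [h1, h3]; ring
  | coe x => show (A 1 0 * x + A 1 1) ^ 2 = _; rw [h1, h2, h3]; ring

theorem dsc_of_chi (A : GL (Fin 2) k) (x : OnePoint k) (hA : A • x = x) (h : chi x A = 1) :
    dsc A = 0 := by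
  have hd := det_eq A
  unfold chi at h
  rw [div_eq_one_iff_eq hd] at h
  unfold dsc
  cases x with
  | infty =>
    rw [OnePoint.smul_infty_eq_self_iff] at hA
    have h : A 0 0 ^ 2 = A 0 0 * A 1 1 - A 0 1 * A 1 0 := h
    rw [hA] at h hd ⊢
    have h0 : A 0 0 ≠ 0 := by intro h0; apply hd; rw [h0]; ring
    have : A 0 0 = A 1 1 := mul_left_cancel₀ h0 (by linear_combination h)
    rw [this]; ring
  | coe x =>
    rw [fix_some] at hA
    have h : (A 1 0 * x + A 1 1) ^ 2 = A 0 0 * A 1 1 - A 0 1 * A 1 0 := h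
    have hdet : A 0 0 * A 1 1 - A 0 1 * A 1 0 = (A 1 0 * x + A 1 1) * (A 0 0 - A 1 0 * x) := by
      linear_combination A 1 0 * hA
    rw [hdet] at h hd
    have h0 : A 1 0 * x + A 1 1 ≠ 0 := left_ne_zero_of_mul hd
    have : A 1 0 * x + A 1 1 = A 0 0 - A 1 0 * x := mul_left_cancel₀ h0 (by linear_combination h)
    linear_combination (A 0 0 - A 1 1 - 2 * A 1 0 * x) * (-this) - 4 * A 1 0 * hA

end geom

open Matrix

/-- Dickson's classification: a finite subgroup of PGL₂(k̄), for k̄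
algebraically closed of characteristic ℓ > 5, with order prime to ℓ, is cyclic,
dihedral, or isomorphic to A₄, S₄, or A₅. -/
theorem stmt5 (ℓ : ℕ) (hℓ : ℓ.Prime) (h5 : 5 < ℓ)
    (kbar : Type*) [Field kbar] [IsAlgClosed kbar] [CharP kbar ℓ]
    (H : Subgroup (GL (Fin 2) kbar ⧸ Subgroup.center (GL (Fin 2) kbar)))
    [Finite H] (hord : ¬ ℓ ∣ Nat.card H) :
    IsCyclic H ∨ (∃ n : ℕ, Nonempty (H ≃* DihedralGroup n)) ∨
      Nonempty (H ≃* alternatingGroup (Fin 4)) ∨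
      Nonempty (H ≃* Equiv.Perm (Fin 4)) ∨
      Nonempty (H ≃* alternatingGroup (Fin 5)) := by
  classical
  have h2 : (2 : kbar) ≠ 0 := by
    have : ((2 : ℕ) : kbar) ≠ 0 := by
      rw [Ne, CharP.cast_eq_zero_iff kbar ℓ]
      intro h
      have := Nat.le_of_dvd (by norm_num) h
      omega
    exact_mod_cast this
  have hN : ((Nat.card H : ℕ) : kbar) ≠ 0 := by
    rwa [Ne, CharP.cast_eq_zero_iff kbar ℓ]
  let Z := Subgroup.center (GL (Fin 2) kbar)
  let φ : (GL (Fin 2) kbar ⧸ Z) →* Equiv.Perm (OnePoint kbar) :=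
    QuotientGroup.lift Z (MulAction.toPermHom (GL (Fin 2) kbar) (OnePoint kbar)) (by
      intro A hA
      ext1 x
      exact center_smul A hA x)
  letI act : MulAction H (OnePoint kbar) := MulAction.compHom _ (φ.comp H.subtype)
  let lft : H → GL (Fin 2) kbar := fun h => Quotient.out h.1
  have hlft : ∀ h : H, (QuotientGroup.mk (lft h) : GL (Fin 2) kbar ⧸ Z) = h.1 :=
    fun h => QuotientGroup.out_eq' h.1
  have hact : ∀ (h : H) (x : OnePoint kbar), h • x = lft h • x := by
    intro h x
    show φ h.1 x = _
    rw [← hlft h]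
    rfl
  have hpow : ∀ h : H, lft h ^ Nat.card H ∈ Z := by
    intro h
    rw [← QuotientGroup.eq_one_iff, QuotientGroup.mk_pow, hlft]
    have := pow_card_eq_one' (G := H) (x := h)
    exact congrArg Subtype.val this
  have hcen : ∀ h : H, lft h ∈ Z ↔ h = 1 := by
    intro h
    rw [← QuotientGroup.eq_one_iff, hlft]
    exact ⟨fun e => Subtype.ext e, fun e => congrArg Subtype.val e⟩
  have hdsc : ∀ h : H, h ≠ 1 → dsc (lft h) ≠ 0 := by
    intro h h1
    exact dsc_ne_zero _ h2 (fun e => h1 ((hcen h).1 e)) _ hN (hpow h)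
  refine core' (X := OnePoint kbar) ?_ ?_
  · intro h h1
    refine Eq.trans ?_ (two_fixed (lft h) h2 (hdsc h h1))
    apply Nat.card_congr
    apply Equiv.subtypeEquivRight
    intro x
    rw [MulAction.mem_fixedBy, hact]
  · intro x
    have hfix : ∀ h : MulAction.stabilizer H x, lft h.1 • x = x := by
      intro h
      rw [← hact]; exact h.2
    let f : MulAction.stabilizer H x →* kbar :=
      { toFun := fun h => chi x (lft h.1)
        map_one' := chi_center _ _ ((hcen _).2 rfl)
        map_mul' := by
          intro a b
          rw [← chi_mul _ _ _ (hfix a) (hfix b)]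
          have hz : (lft a.1 * lft b.1)⁻¹ * lft (a * b).1 ∈ Z := by
            rw [← QuotientGroup.eq, QuotientGroup.mk_mul, hlft, hlft, hlft]
            rfl
          have e : lft (a * b).1 = (lft a.1 * lft b.1) * ((lft a.1 * lft b.1)⁻¹ * lft (a * b).1) := by
            group
          rw [e, chi_mul _ _ _ ?_ (center_smul _ hz x), chi_center _ _ hz, mul_one]
          rw [mul_smul, hfix, hfix] }
    refine isCyclic_of_injective_ringHom f ?_
    rw [injective_iff_map_eq_one]
    intro a ha
    by_contra hne
    exact hdsc a.1 (fun h => hne (Subtype.ext h)) (dsc_of_chi _ x (hfix a) ha)
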